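/- Let n ≥ 1, n < p < +∞, and γ ∈ ℝ with γ > p − n. There exists a constant C > 0, depending only on n, γ and p, such that every function u : ℝⁿ → ℝ that is continuously differentiable on ℝⁿ₊ satisfies, for all x ∈ ℝⁿ₊ and all R > 0, (1/|C_R(x)|) ∫_{C_R(x)} |u(x) − u(z)| dz ≤ C · min(xₙ, R)^{1 − n/p} · xₙ^{−γ/p} · ( ∫_{C_R(x)} ‖Du(z)‖^p zₙ^γ dz )^{1/p}. -/

import Mathlib

open MeasureTheory Real Set
open scoped ENNReal

noncomputable section

/-- The last coordinate `xₙ` of a point of `ℝⁿ`. -/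
def lastCoord (n : ℕ) (x : EuclideanSpace ℝ (Fin n)) : ℝ :=
  if h : 0 < n then x ⟨n - 1, Nat.sub_lt h one_pos⟩ else 0

/-- The open upper half-space `ℝⁿ₊`. -/
def upperHalf (n : ℕ) : Set (EuclideanSpace ℝ (Fin n)) :=
  {z | 0 < lastCoord n z}

/-- The weighted energy `E_γ(u) = ∫_{ℝⁿ₊} ‖Du(z)‖^p zₙ^γ dz`, as a value in `[0, +∞]`. -/
def energy (n : ℕ) (γ p : ℝ) (u : EuclideanSpace ℝ (Fin n) → ℝ) : ℝ≥0∞ :=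
  ∫⁻ z in upperHalf n, ENNReal.ofReal (‖fderiv ℝ u z‖ ^ p * lastCoord n z ^ γ)

/-- The Euclidean norm of the first `n - 1` coordinates of a point of `ℝⁿ`,
i.e. `|x′|` where `x = (x′, xₙ)`. -/
def sideNorm (n : ℕ) (x : EuclideanSpace ℝ (Fin n)) : ℝ :=
  Real.sqrt (∑ i ∈ Finset.univ.filter (fun i : Fin n => (i : ℕ) < n - 1), x i ^ 2)

/-- The upward cone `C_R(x) = {z ∈ ℝⁿ : |z′ − x′| < zₙ − xₙ < R}`. -/
def cone (n : ℕ) (R : ℝ) (x : EuclideanSpace ℝ (Fin n)) : Set (EuclideanSpace ℝ (Fin n)) :=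
  {z | sideNorm n (z - x) < lastCoord n (z - x) ∧ lastCoord n (z - x) < R}

section Geometry

variable {n : ℕ}

lemma lastCoord_add (x y : EuclideanSpace ℝ (Fin n)) :
    lastCoord n (x + y) = lastCoord n x + lastCoord n y := by
  unfold lastCoord; split_ifs <;> simp

lemma lastCoord_smul (s : ℝ) (x : EuclideanSpace ℝ (Fin n)) :
    lastCoord n (s • x) = s * lastCoord n x := by
  unfold lastCoord; split_ifs <;> simp

lemma continuous_lastCoord : Continuous (lastCoord n) := by
  unfold lastCoord
  split_ifs
  · fun_prop
  · exact continuous_const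

lemma continuous_sideNorm : Continuous (sideNorm n) := by
  unfold sideNorm; fun_prop

lemma sideNorm_smul {s : ℝ} (hs : 0 ≤ s) (x : EuclideanSpace ℝ (Fin n)) :
    sideNorm n (s • x) = s * sideNorm n x := by
  unfold sideNorm
  simp only [PiLp.smul_apply, smul_eq_mul, mul_pow, ← Finset.mul_sum]
  rw [Real.sqrt_mul (sq_nonneg s), Real.sqrt_sq hs]

lemma sideNorm_nonneg (x : EuclideanSpace ℝ (Fin n)) : 0 ≤ sideNorm n x :=
  Real.sqrt_nonneg _

lemma norm_sq_eq_sideNorm_sq_add_lastCoord_sq (hn : 1 ≤ n) (x : EuclideanSpace ℝ (Fin n)) :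
    ‖x‖ ^ 2 = sideNorm n x ^ 2 + lastCoord n x ^ 2 := by
  rw [EuclideanSpace.real_norm_sq_eq, sideNorm,
    Real.sq_sqrt (Finset.sum_nonneg fun i _ => sq_nonneg _), lastCoord, dif_pos (by omega),
    ← Finset.sum_filter_add_sum_filter_not Finset.univ (fun i : Fin n => (i : ℕ) < n - 1)]
  congr 1
  have : Finset.univ.filter (fun i : Fin n => ¬ (i : ℕ) < n - 1) = {⟨n - 1, by omega⟩} := by
    ext i
    simp only [Finset.mem_filter, Finset.mem_univ, true_and, Finset.mem_singleton, Fin.ext_iff]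
    omega
  rw [this, Finset.sum_singleton]

lemma lastCoord_pos_of_mem_cone {R : ℝ} {w : EuclideanSpace ℝ (Fin n)} (hw : w ∈ cone n R 0) :
    0 < lastCoord n w := by
  have h := hw.1
  rw [sub_zero] at h
  exact (sideNorm_nonneg w).trans_lt h

lemma lastCoord_lt_of_mem_cone {R : ℝ} {w : EuclideanSpace ℝ (Fin n)} (hw : w ∈ cone n R 0) :
    lastCoord n w < R := by
  simpa using hw.2

lemma norm_le_two_mul_lastCoord (hn : 1 ≤ n) {R : ℝ} {w : EuclideanSpace ℝ (Fin n)}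
    (hw : w ∈ cone n R 0) : ‖w‖ ≤ 2 * lastCoord n w := by
  have h := hw.1
  rw [sub_zero] at h
  have h0 := sideNorm_nonneg w
  have h1 := norm_sq_eq_sideNorm_sq_add_lastCoord_sq hn w
  exact abs_le_of_sq_le_sq' (by nlinarith) (by linarith) |>.2

lemma isOpen_cone (R : ℝ) (x : EuclideanSpace ℝ (Fin n)) : IsOpen (cone n R x) := by
  have h : Continuous fun z : EuclideanSpace ℝ (Fin n) => z - x := by fun_prop
  exact (isOpen_lt (continuous_sideNorm.comp h) (continuous_lastCoord.comp h)).inter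
    (isOpen_lt (continuous_lastCoord.comp h) continuous_const)

lemma isOpen_upperHalf : IsOpen (upperHalf n) :=
  isOpen_lt continuous_const continuous_lastCoord

lemma cone_mono {R S : ℝ} (h : R ≤ S) (x : EuclideanSpace ℝ (Fin n)) :
    cone n R x ⊆ cone n S x := fun _ hz => ⟨hz.1, hz.2.trans_le h⟩

lemma preimage_cone {s : ℝ} (hs : 0 < s) (x : EuclideanSpace ℝ (Fin n)) :
    (fun w => x + s • w) ⁻¹' cone n s x = cone n 1 0 := by
  ext w
  simp only [cone, mem_preimage, mem_ofPred_eq, add_sub_cancel_left, sub_zero, lastCoord_smul,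
    sideNorm_smul hs.le, mul_lt_mul_iff_right₀ hs, mul_lt_iff_lt_one_right hs]

lemma volume_unit_cone_pos (hn : 1 ≤ n) : 0 < volume (cone n 1 0) := by
  refine (isOpen_cone 1 0).measure_pos volume ⟨EuclideanSpace.single ⟨n - 1, by omega⟩ (1 / 2), ?_⟩
  have h1 : lastCoord n (EuclideanSpace.single (⟨n - 1, by omega⟩ : Fin n) (1 / 2 : ℝ)) = 1 / 2 := by
    simp [lastCoord, show 0 < n by omega]
  have h2 : sideNorm n (EuclideanSpace.single (⟨n - 1, by omega⟩ : Fin n) (1 / 2 : ℝ)) = 0 := by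
    rw [sideNorm, Finset.sum_eq_zero, Real.sqrt_zero]
    intro i hi
    have : i ≠ ⟨n - 1, by omega⟩ := by
      rintro rfl
      simp at hi
    simp [this]
  constructor
  · rw [sub_zero, h1, h2]; norm_num
  · rw [sub_zero, h1]; norm_num

lemma volume_unit_cone_lt_top (hn : 1 ≤ n) : volume (cone n 1 0) < ∞ := by
  refine (measure_mono fun w hw => ?_).trans_lt
    (measure_closedBall_lt_top (x := (0 : EuclideanSpace ℝ (Fin n))) (r := 2))
  rw [mem_closedBall_zero_iff]
  linarith [norm_le_two_mul_lastCoord hn hw, lastCoord_lt_of_mem_cone hw]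

lemma setLIntegral_cone_eq {s : ℝ} (hs : 0 < s) (x : EuclideanSpace ℝ (Fin n))
    (g : EuclideanSpace ℝ (Fin n) → ℝ≥0∞) :
    ∫⁻ w in cone n 1 0, g (x + s • w) =
      ENNReal.ofReal (s ^ n)⁻¹ * ∫⁻ z in cone n s x, g z := by
  have hmap : Measure.map (fun w : EuclideanSpace ℝ (Fin n) => x + s • w) volume =
      ENNReal.ofReal (s ^ n)⁻¹ • volume := by
    have : (fun w : EuclideanSpace ℝ (Fin n) => x + s • w) = (fun w => x + w) ∘ (fun w => s • w) :=
      rfl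
    rw [this, ← Measure.map_map (by fun_prop) (by fun_prop), Measure.map_addHaar_smul _ hs.ne',
      Measure.map_smul, map_add_left_eq_self, finrank_euclideanSpace_fin,
      abs_of_pos (by positivity)]
  have hemb : MeasurableEmbedding (fun w : EuclideanSpace ℝ (Fin n) => x + s • w) :=
    (measurableEmbedding_addLeft x).comp (measurableEmbedding_const_smul₀ hs.ne')
  rw [← preimage_cone hs x, ← hemb.lintegral_map, ← hemb.restrict_map, hmap,
    Measure.restrict_smul, lintegral_smul_measure, smul_eq_mul]

lemma cone_average_eq {R : ℝ} (hR : 0 < R) (x : EuclideanSpace ℝ (Fin n))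
    (g : EuclideanSpace ℝ (Fin n) → ℝ≥0∞) :
    (volume (cone n R x))⁻¹ * ∫⁻ z in cone n R x, g z =
      (volume (cone n 1 0))⁻¹ * ∫⁻ w in cone n 1 0, g (x + R • w) := by
  have h := setLIntegral_cone_eq hR x (fun _ => 1)
  simp only [setLIntegral_one] at h
  have h0 : ENNReal.ofReal (R ^ n)⁻¹ ≠ 0 := by
    rw [Ne, ENNReal.ofReal_eq_zero, not_le]; positivity
  rw [setLIntegral_cone_eq hR x g, h, ENNReal.mul_inv (Or.inl h0) (Or.inl ENNReal.ofReal_ne_top),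
    mul_mul_mul_comm, ENNReal.inv_mul_cancel h0 ENNReal.ofReal_ne_top, one_mul]

end Geometry

/-- Hölder's inequality against the constant function `1`. -/
lemma lintegral_rpow_inv_le {α : Type*} [MeasurableSpace α] {μ : Measure α} {p : ℝ} (hp : 1 < p)
    {G : α → ℝ≥0∞} (hG : AEMeasurable G μ) :
    ∫⁻ a, G a ^ (1 / p) ∂μ ≤ (∫⁻ a, G a ∂μ) ^ (1 / p) * μ univ ^ (1 - 1 / p) := by
  have hc := Real.HolderConjugate.conjExponent hp
  have h := ENNReal.lintegral_mul_le_Lp_mul_Lq μ hc (hG.pow_const (1 / p))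
    (aemeasurable_const (b := (1 : ℝ≥0∞)))
  have hp0 : p ≠ 0 := by positivity
  simpa [← ENNReal.rpow_mul, hp0, hc.one_sub_inv] using h

/-- The weight `X ^ b` can be traded for a decaying factor in `s`. -/
lemma le_rpow_mul_min_mul_rpow {X s t a b : ℝ} (hX : 0 < X) (hs : 0 < s) (ht : 0 < t)
    (ht1 : t ≤ 1) (ha : 0 ≤ a) (ha1 : a ≤ 1) (hab : a ≤ b) :
    t ≤ X ^ (-b) * min 1 ((X / s) ^ a) * (X + s * t) ^ b := by
  have hst : 0 < s * t := mul_pos hs ht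
  have h1 : (X + s * t) ^ b = X ^ b * ((X + s * t) / X) ^ b := by
    rw [← Real.mul_rpow hX.le (by positivity)]; congr 1; field_simp
  have hr : 1 ≤ (X + s * t) / X := by rw [le_div_iff₀ hX]; linarith
  have hX' : X ^ (-b) * X ^ b = 1 := by rw [← Real.rpow_add hX]; simp
  have h2 : X ^ (-b) * min 1 ((X / s) ^ a) * (X + s * t) ^ b =
      min 1 ((X / s) ^ a) * ((X + s * t) / X) ^ b := by
    rw [h1]; linear_combination (min 1 ((X / s) ^ a) * ((X + s * t) / X) ^ b) * hX'
  rw [h2]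
  have h3 : 1 ≤ ((X + s * t) / X) ^ b := Real.one_le_rpow hr (ha.trans hab)
  rcases min_cases 1 ((X / s) ^ a) with ⟨h, -⟩ | ⟨h, -⟩ <;> rw [h]
  · linarith
  calc t = t ^ (1 : ℝ) := (Real.rpow_one t).symm
    _ ≤ t ^ a := Real.rpow_le_rpow_of_exponent_ge ht ht1 ha1
    _ = (X / s) ^ a * (s * t / X) ^ a := by
      rw [← Real.mul_rpow (by positivity) (by positivity)]; congr 1; field_simp
    _ ≤ (X / s) ^ a * ((X + s * t) / X) ^ a := by gcongr; linarith
    _ ≤ (X / s) ^ a * ((X + s * t) / X) ^ b := by gcongr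

lemma setLIntegral_Ioc_rpow_neg {q : ℝ} (hq1 : q < 1) {m : ℝ} (hm : 0 < m) :
    ∫⁻ s in Ioc 0 m, ENNReal.ofReal (s ^ (-q)) = ENNReal.ofReal (m ^ (1 - q) / (1 - q)) := by
  have hint : IntegrableOn (fun s : ℝ => s ^ (-q)) (Ioc 0 m) := by
    rw [← intervalIntegrable_iff_integrableOn_Ioc_of_le hm.le]
    exact intervalIntegral.intervalIntegrable_rpow' (by linarith)
  rw [← ofReal_integral_eq_lintegral_ofReal hint, ← intervalIntegral.integral_of_le hm.le,
    integral_rpow (Or.inl (by linarith)), Real.zero_rpow (by linarith), sub_zero,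
    neg_add_eq_sub]
  filter_upwards [self_mem_ae_restrict measurableSet_Ioc] with s hs
  exact Real.rpow_nonneg hs.1.le _

lemma setLIntegral_Ioi_rpow_neg {r : ℝ} (hr : 1 < r) {X : ℝ} (hX : 0 < X) :
    ∫⁻ s in Ioi X, ENNReal.ofReal (s ^ (-r)) = ENNReal.ofReal (X ^ (1 - r) / (r - 1)) := by
  rw [← ofReal_integral_eq_lintegral_ofReal (integrableOn_Ioi_rpow_of_lt (by linarith) hX),
    integral_Ioi_rpow_of_lt (by linarith) hX, neg_add_eq_sub, ← neg_sub r 1, neg_div_neg_eq]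
  filter_upwards [self_mem_ae_restrict measurableSet_Ioi] with s hs
  exact Real.rpow_nonneg (hX.trans hs).le _

lemma setLIntegral_min_mul_rpow_le {q a : ℝ} (hq1 : q < 1) (ha : 1 - q < a) {X R : ℝ}
    (hX : 0 < X) (hR : 0 < R) :
    ∫⁻ s in Ioc 0 R, ENNReal.ofReal (min 1 ((X / s) ^ a) * s ^ (-q)) ≤
      ENNReal.ofReal ((1 / (1 - q) + 1 / (q + a - 1)) * min X R ^ (1 - q)) := by
  have hm : 0 < min X R := lt_min hX hR
  have hq : 0 < 1 - q := by linarith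
  have hqa : 0 < q + a - 1 := by linarith
  have hsub : Ioc 0 R ⊆ Ioc 0 (min X R) ∪ Ioc X R := by
    intro s hs
    rcases le_or_gt s X with h | h
    · exact Or.inl ⟨hs.1, le_min h hs.2⟩
    · exact Or.inr ⟨h, hs.2⟩
  have hfst : ∫⁻ s in Ioc 0 (min X R), ENNReal.ofReal (min 1 ((X / s) ^ a) * s ^ (-q)) ≤
      ENNReal.ofReal (1 / (1 - q) * min X R ^ (1 - q)) := by
    rw [one_div_mul_eq_div, ← setLIntegral_Ioc_rpow_neg hq1 hm]
    refine setLIntegral_mono' measurableSet_Ioc fun s hs => ENNReal.ofReal_le_ofReal ?_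
    exact mul_le_of_le_one_left (Real.rpow_nonneg hs.1.le _) (min_le_left _ _)
  have hsnd : ∫⁻ s in Ioc X R, ENNReal.ofReal (min 1 ((X / s) ^ a) * s ^ (-q)) ≤
      ENNReal.ofReal (1 / (q + a - 1) * min X R ^ (1 - q)) := by
    rcases le_or_gt R X with h | h
    · simp [Ioc_eq_empty_of_le h]
    rw [min_eq_left h.le]
    calc ∫⁻ s in Ioc X R, ENNReal.ofReal (min 1 ((X / s) ^ a) * s ^ (-q))
        ≤ ∫⁻ s in Ioc X R, ENNReal.ofReal (X ^ a) * ENNReal.ofReal (s ^ (-(q + a))) := by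
          refine setLIntegral_mono' measurableSet_Ioc fun s hs => ?_
          have hs0 : 0 < s := hX.trans hs.1
          rw [← ENNReal.ofReal_mul (by positivity)]
          refine ENNReal.ofReal_le_ofReal ?_
          calc min 1 ((X / s) ^ a) * s ^ (-q) ≤ (X / s) ^ a * s ^ (-q) := by
                gcongr; exact min_le_right _ _
            _ = X ^ a * s ^ (-(q + a)) := by
                rw [Real.div_rpow hX.le hs0.le, neg_add, Real.rpow_add hs0, Real.rpow_neg hs0.le a]
                ring
      _ ≤ ∫⁻ s in Ioi X, ENNReal.ofReal (X ^ a) * ENNReal.ofReal (s ^ (-(q + a))) :=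
          lintegral_mono_set Ioc_subset_Ioi_self
      _ = ENNReal.ofReal (1 / (q + a - 1) * X ^ (1 - q)) := by
          rw [lintegral_const_mul' _ _ ENNReal.ofReal_ne_top,
            setLIntegral_Ioi_rpow_neg (by linarith) hX, ← ENNReal.ofReal_mul (by positivity),
            show (1 : ℝ) - q = a + (1 - (q + a)) by ring, Real.rpow_add hX]
          congr 1; ring
  calc _ ≤ ∫⁻ s in Ioc 0 (min X R) ∪ Ioc X R, ENNReal.ofReal (min 1 ((X / s) ^ a) * s ^ (-q)) :=
        lintegral_mono_set hsub
    _ ≤ _ := lintegral_union_le _ _ _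
    _ ≤ _ := add_le_add hfst hsnd
    _ = _ := by rw [← ENNReal.ofReal_add (by positivity) (by positivity), add_mul]

section Segment

variable {n : ℕ}

lemma add_smul_mem_upperHalf {x w : EuclideanSpace ℝ (Fin n)} (hx : x ∈ upperHalf n)
    (hw : 0 < lastCoord n w) {s : ℝ} (hs : 0 ≤ s) : x + s • w ∈ upperHalf n := by
  have hx0 : 0 < lastCoord n x := hx
  change 0 < lastCoord n (x + s • w)
  rw [lastCoord_add, lastCoord_smul]
  positivity

lemma ofReal_abs_sub_le_lintegral_fderiv {u : EuclideanSpace ℝ (Fin n) → ℝ}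
    (hu : ContDiffOn ℝ 1 u (upperHalf n)) {x w : EuclideanSpace ℝ (Fin n)}
    (hx : x ∈ upperHalf n) (hw : 0 < lastCoord n w) {R : ℝ} (hR : 0 ≤ R) :
    ENNReal.ofReal |u x - u (x + R • w)| ≤
      ∫⁻ s in Ioc 0 R, ENNReal.ofReal (‖fderiv ℝ u (x + s • w)‖ * ‖w‖) := by
  have hmaps : MapsTo (fun s : ℝ => x + s • w) (Icc 0 R) (upperHalf n) :=
    fun s hs => add_smul_mem_upperHalf hx hw hs.1
  have hc : ContDiffOn ℝ 1 (fun s : ℝ => u (x + s • w)) (Icc 0 R) :=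
    hu.comp (by fun_prop) hmaps
  have h := enorm_sub_le_lintegral_deriv_of_contDiffOn_Icc hc hR
  simp only [zero_smul, add_zero] at h
  rw [abs_sub_comm, ← Real.norm_eq_abs, ofReal_norm]
  refine h.trans ?_
  rw [restrict_Ioc_eq_restrict_Icc]
  refine setLIntegral_mono' measurableSet_Icc fun s hs => ?_
  have hd : HasFDerivAt u (fderiv ℝ u (x + s • w)) (x + s • w) :=
    ((hu.differentiableOn one_ne_zero).differentiableAt
      (isOpen_upperHalf.mem_nhds (hmaps hs))).hasFDerivAt
  have hl : HasDerivAt (fun s : ℝ => x + s • w) w s := by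
    simpa using ((hasDerivAt_id s).smul_const w).const_add x
  have hcomp : deriv (fun s : ℝ => u (x + s • w)) s = fderiv ℝ u (x + s • w) w :=
    (hd.comp_hasDerivAt s hl).deriv
  rw [hcomp, ← ofReal_norm]
  exact ENNReal.ofReal_le_ofReal (ContinuousLinearMap.le_opNorm _ _)

lemma norm_fderiv_mul_norm_le (hn : 1 ≤ n) (u : EuclideanSpace ℝ (Fin n) → ℝ)
    {x w : EuclideanSpace ℝ (Fin n)} (hx : x ∈ upperHalf n) (hw : w ∈ cone n 1 0)
    {p γ a s : ℝ} (hp : 0 < p) (hs : 0 < s) (ha : 0 ≤ a) (ha1 : a ≤ 1) (hab : a ≤ γ / p) :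
    ENNReal.ofReal (‖fderiv ℝ u (x + s • w)‖ * ‖w‖) ≤
      ENNReal.ofReal (2 * (lastCoord n x ^ (-γ / p) * min 1 ((lastCoord n x / s) ^ a))) *
        ENNReal.ofReal (‖fderiv ℝ u (x + s • w)‖ ^ p * lastCoord n (x + s • w) ^ γ) ^ (1 / p) := by
  have hX : 0 < lastCoord n x := hx
  have hw0 := lastCoord_pos_of_mem_cone hw
  have hz : 0 < lastCoord n (x + s • w) := add_smul_mem_upperHalf hx hw0 hs.le
  have hkey := le_rpow_mul_min_mul_rpow hX hs hw0 (lastCoord_lt_of_mem_cone hw).le ha ha1 hab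
  rw [← lastCoord_smul, ← lastCoord_add, ← neg_div] at hkey
  have hm : 0 ≤ min 1 ((lastCoord n x / s) ^ a) := le_min zero_le_one (by positivity)
  rw [ENNReal.ofReal_rpow_of_nonneg (by positivity) (by positivity),
    ← ENNReal.ofReal_mul (by positivity)]
  refine ENNReal.ofReal_le_ofReal ?_
  rw [Real.mul_rpow (by positivity) (by positivity), ← Real.rpow_mul (norm_nonneg _),
    ← Real.rpow_mul hz.le, mul_one_div_cancel hp.ne', Real.rpow_one, mul_one_div]
  calc ‖fderiv ℝ u (x + s • w)‖ * ‖w‖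
      ≤ ‖fderiv ℝ u (x + s • w)‖ * (2 * lastCoord n w) := by
        gcongr; exact norm_le_two_mul_lastCoord hn hw
    _ ≤ ‖fderiv ℝ u (x + s • w)‖ * (2 * (lastCoord n x ^ (-γ / p) *
          min 1 ((lastCoord n x / s) ^ a) * lastCoord n (x + s • w) ^ (γ / p))) := by gcongr
    _ = _ := by ring

lemma setLIntegral_unit_cone_rpow_le {p : ℝ} (hp : 1 < p)
    {G : EuclideanSpace ℝ (Fin n) → ℝ≥0∞} (hG : Measurable G) {s R : ℝ} (hs : 0 < s) (hsR : s ≤ R)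
    (x : EuclideanSpace ℝ (Fin n)) :
    ∫⁻ w in cone n 1 0, G (x + s • w) ^ (1 / p) ≤
      ENNReal.ofReal (s ^ (-(n / p))) *
        ((∫⁻ z in cone n R x, G z) ^ (1 / p) * volume (cone n 1 0) ^ (1 - 1 / p)) := by
  have h := lintegral_rpow_inv_le (μ := volume.restrict (cone n 1 0)) hp
    (G := fun w => G (x + s • w)) (hG.comp (by fun_prop)).aemeasurable
  refine h.trans ?_
  rw [setLIntegral_cone_eq hs, Measure.restrict_apply_univ,
    ENNReal.mul_rpow_of_nonneg _ _ (by positivity),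
    ENNReal.ofReal_rpow_of_nonneg (by positivity) (by positivity), mul_assoc]
  have hexp : ((s ^ n)⁻¹) ^ (1 / p) = s ^ (-(n / p)) := by
    rw [← Real.rpow_natCast, ← Real.rpow_neg hs.le, ← Real.rpow_mul hs.le]
    congr 1; ring
  rw [hexp]
  gcongr
  exact cone_mono hsR x

lemma cone_average_le (hn : 1 ≤ n) {p γ a : ℝ} (hp : 1 < p) (ha : 0 ≤ a) (ha1 : a ≤ 1)
    (hab : a ≤ γ / p) {u : EuclideanSpace ℝ (Fin n) → ℝ} (hu : ContDiffOn ℝ 1 u (upperHalf n))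
    {x : EuclideanSpace ℝ (Fin n)} (hx : x ∈ upperHalf n) {R : ℝ} (hR : 0 < R) :
    (volume (cone n R x))⁻¹ * (∫⁻ z in cone n R x, ENNReal.ofReal |u x - u z|) ≤
      (volume (cone n 1 0))⁻¹ * volume (cone n 1 0) ^ (1 - 1 / p) *
        ENNReal.ofReal (2 * lastCoord n x ^ (-γ / p)) *
        (∫⁻ s in Ioc 0 R, ENNReal.ofReal (min 1 ((lastCoord n x / s) ^ a) * s ^ (-(n / p)))) *
        (∫⁻ z in cone n R x,
          ENNReal.ofReal (‖fderiv ℝ u z‖ ^ p * lastCoord n z ^ γ)) ^ (1 / p) := by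
  have hX : 0 < lastCoord n x := hx
  have hp0 : 0 < p := by linarith
  have hmeas : MeasurableSet (cone n 1 0) := (isOpen_cone 1 0).measurableSet
  set G : EuclideanSpace ℝ (Fin n) → ℝ≥0∞ :=
    fun z => ENNReal.ofReal (‖fderiv ℝ u z‖ ^ p * lastCoord n z ^ γ) with hGdef
  set m : ℝ → ℝ := fun s => min 1 ((lastCoord n x / s) ^ a) with hmdef
  have hfm := measurable_fderiv ℝ u
  have hlm : Measurable (lastCoord n) := continuous_lastCoord.measurable
  have hG : Measurable G :=
    ((hfm.norm.pow_const p).mul (hlm.pow_const γ)).ennreal_ofReal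
  have hm0 : ∀ s, 0 < s → 0 ≤ m s := fun s hs => le_min zero_le_one (by positivity)
  have hmm : Measurable m := by fun_prop
  rw [cone_average_eq hR x fun z => ENNReal.ofReal |u x - u z|]
  simp only [mul_assoc]
  gcongr
  calc ∫⁻ w in cone n 1 0, ENNReal.ofReal |u x - u (x + R • w)|
      ≤ ∫⁻ w in cone n 1 0, ∫⁻ s in Ioc 0 R,
          ENNReal.ofReal (‖fderiv ℝ u (x + s • w)‖ * ‖w‖) :=
        setLIntegral_mono' hmeas fun w hw =>
          ofReal_abs_sub_le_lintegral_fderiv hu hx (lastCoord_pos_of_mem_cone hw) hR.le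
    _ = ∫⁻ s in Ioc 0 R, ∫⁻ w in cone n 1 0,
          ENNReal.ofReal (‖fderiv ℝ u (x + s • w)‖ * ‖w‖) := by
        refine lintegral_lintegral_swap (Measurable.aemeasurable ?_)
        have : Measurable fun q : EuclideanSpace ℝ (Fin n) × ℝ => fderiv ℝ u (x + q.2 • q.1) :=
          hfm.comp (by fun_prop)
        exact (this.norm.mul measurable_fst.norm).ennreal_ofReal
    _ ≤ ∫⁻ s in Ioc 0 R, ENNReal.ofReal (2 * (lastCoord n x ^ (-γ / p) * m s)) *
          ∫⁻ w in cone n 1 0, G (x + s • w) ^ (1 / p) := by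
        refine setLIntegral_mono' measurableSet_Ioc fun s hs => ?_
        rw [← lintegral_const_mul' _ _ ENNReal.ofReal_ne_top]
        exact setLIntegral_mono' hmeas fun w hw =>
          norm_fderiv_mul_norm_le hn u hx hw hp0 hs.1 ha ha1 hab
    _ ≤ ∫⁻ s in Ioc 0 R, ENNReal.ofReal (m s * s ^ (-(n / p))) *
          (volume (cone n 1 0) ^ (1 - 1 / p) * ENNReal.ofReal (2 * lastCoord n x ^ (-γ / p)) *
            (∫⁻ z in cone n R x, G z) ^ (1 / p)) := by
        refine setLIntegral_mono' measurableSet_Ioc fun s hs => ?_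
        refine (mul_le_mul_right (setLIntegral_unit_cone_rpow_le hp hG hs.1 hs.2 x) _).trans_eq ?_
        rw [← mul_assoc 2, ENNReal.ofReal_mul (by positivity), ENNReal.ofReal_mul (hm0 s hs.1)]
        ring
    _ = _ := by
        rw [lintegral_mul_const]
        · ring
        · exact (hmm.mul (measurable_id.pow_const _)).ennreal_ofReal

end Segment

/-- Estimate on cone averages, case `γ > p - n`. -/
theorem cone_average_estimate_gt (n : ℕ) (hn : 1 ≤ n) (p γ : ℝ)
    (hnp : (n : ℝ) < p) (hγ : p - n < γ) :
    ∃ C : ℝ, 0 < C ∧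
      ∀ u : EuclideanSpace ℝ (Fin n) → ℝ,
        ContDiffOn ℝ 1 u (upperHalf n) →
        ∀ x ∈ upperHalf n, ∀ R > (0 : ℝ),
          (volume (cone n R x))⁻¹ * (∫⁻ z in cone n R x, ENNReal.ofReal |u x - u z|) ≤
            ENNReal.ofReal
                (C * min (lastCoord n x) R ^ (1 - (n : ℝ) / p) * lastCoord n x ^ (-γ / p)) *
              (∫⁻ z in cone n R x,
                  ENNReal.ofReal (‖fderiv ℝ u z‖ ^ p * lastCoord n z ^ γ)) ^ (1 / p) := by
  have hn' : (1 : ℝ) ≤ n := by exact_mod_cast hn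
  have hp : 1 < p := by linarith
  have hp0 : 0 < p := by linarith
  have hq0 : 0 < (n : ℝ) / p := by positivity
  have hq1 : (n : ℝ) / p < 1 := (div_lt_one hp0).2 hnp
  have hqγ : 1 - (n : ℝ) / p < γ / p := by
    rw [one_sub_div hp0.ne']
    gcongr
  obtain ⟨a, haq, ha⟩ := exists_between (lt_min hqγ (by linarith : 1 - (n : ℝ) / p < 1))
  obtain ⟨haγ, ha1⟩ := lt_min_iff.1 ha
  have hK0 := (volume_unit_cone_pos hn).ne'
  have hKtop := (volume_unit_cone_lt_top hn).ne
  set K := (volume (cone n 1 0))⁻¹ * volume (cone n 1 0) ^ (1 - 1 / p) with hK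
  have hKfin : K ≠ ∞ :=
    ENNReal.mul_ne_top (ENNReal.inv_ne_top.2 hK0) (ENNReal.rpow_ne_top_of_ne_zero hK0 hKtop)
  have hKpos : 0 < K.toReal :=
    ENNReal.toReal_pos (mul_ne_zero (ENNReal.inv_ne_zero.2 hKtop)
      (ENNReal.rpow_pos (pos_iff_ne_zero.2 hK0) hKtop).ne') hKfin
  have hc1 : 0 < 1 - (n : ℝ) / p := by linarith
  have hc2 : 0 < (n : ℝ) / p + a - 1 := by linarith
  refine ⟨K.toReal * 2 * (1 / (1 - n / p) + 1 / (n / p + a - 1)), by positivity,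
    fun u hu x hx R hR => ?_⟩
  have hX : 0 < lastCoord n x := hx
  have hmin : 0 < min (lastCoord n x) R := lt_min hX hR
  refine (cone_average_le hn hp (by linarith) ha1.le haγ.le hu hx hR).trans ?_
  gcongr
  calc K * ENNReal.ofReal (2 * lastCoord n x ^ (-γ / p)) * _
      ≤ K * ENNReal.ofReal (2 * lastCoord n x ^ (-γ / p)) * _ :=
        mul_le_mul_right (setLIntegral_min_mul_rpow_le hq1 haq hX hR) _
    _ = _ := by
      nth_rw 1 [← ENNReal.ofReal_toReal hKfin]
      rw [← ENNReal.ofReal_mul (by positivity), ← ENNReal.ofReal_mul (by positivity)]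
      congr 1
      ring
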